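/- Let N : ℝ → ℝ be twice continuously differentiable with N(E) = 0 for E ≤ 0, with |N(E)| + |N′(E)| + |N″(E)| ≤ C(1+|E|)^k for some constants C > 0, k ∈ ℕ, and let ε_F > 0 satisfy N′(ε_F) > 0. Suppose T₁ > 0 and μ : (0,T₁) → ℝ is a function satisfying ∫_{−∞}^{∞} N′(E) · f_T(E−μ(T)) dE = N(ε_F) for all T ∈ (0,T₁) and μ(T) → ε_F as T → 0⁺. Then ( μ(T) − ε_F )/T² converges to −(π²/6) · N″(ε_F)/N′(ε_F) as T → 0⁺. -/

import Mathlib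

open Filter MeasureTheory

theorem integrable_one_add_abs_pow_mul_exp_neg_abs (k : ℕ) :
    Integrable fun x : ℝ => (1 + |x|) ^ k * Real.exp (-|x|) := by
  refine (integrable_inv_one_add_sq.const_mul (Real.exp 1 * (k + 2).factorial)).mono'
    (by fun_prop) (ae_of_all _ fun x => ?_)
  have ht : 0 ≤ |x| := abs_nonneg x
  have hfac : (0 : ℝ) < (k + 2).factorial := by positivity
  have hexp := Real.pow_div_factorial_le_exp (1 + |x|) (by positivity) (k + 2)
  rw [div_le_iff₀ hfac, Real.exp_add] at hexp
  rw [Real.norm_of_nonneg (by positivity), ← div_eq_mul_inv, le_div_iff₀ (by positivity),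
    Real.exp_neg, mul_right_comm, ← div_eq_mul_inv, div_le_iff₀ (Real.exp_pos _)]
  calc (1 + |x|) ^ k * (1 + x ^ 2) ≤ (1 + |x|) ^ k * (1 + |x|) ^ 2 := by
        gcongr
        nlinarith [sq_abs x]
    _ = (1 + |x|) ^ (k + 2) := by ring
    _ ≤ _ := by linarith

/-- Minus the derivative of the Fermi function at unit temperature. -/
noncomputable def fermiWeight (x : ℝ) : ℝ := Real.exp x / (1 + Real.exp x) ^ 2

theorem continuous_fermiWeight : Continuous fermiWeight := by
  unfold fermiWeight
  exact Real.continuous_exp.div (by fun_prop) fun x => by positivity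

theorem fermiWeight_nonneg (x : ℝ) : 0 ≤ fermiWeight x := by
  unfold fermiWeight
  positivity

theorem fermiWeight_neg (x : ℝ) : fermiWeight (-x) = fermiWeight x := by
  have := Real.exp_pos x
  unfold fermiWeight
  rw [Real.exp_neg]
  field_simp
  ring

theorem fermiWeight_abs (x : ℝ) : fermiWeight |x| = fermiWeight x := by
  rcases abs_choice x with h | h <;> rw [h]
  exact fermiWeight_neg x

theorem fermiWeight_le_exp_neg_abs (x : ℝ) : fermiWeight x ≤ Real.exp (-|x|) := by
  rw [← fermiWeight_abs, fermiWeight, Real.exp_neg, div_le_iff₀ (by positivity),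
    inv_mul_eq_div, le_div_iff₀ (Real.exp_pos _)]
  nlinarith [Real.exp_pos |x|]

theorem hasDerivAt_fermi (x : ℝ) :
    HasDerivAt (fun y : ℝ => (1 + Real.exp y)⁻¹) (-fermiWeight x) x := by
  have h := ((Real.hasDerivAt_exp x).const_add 1).fun_inv (by positivity)
  rw [neg_div] at h
  exact h

/-- Continuous functions of polynomial growth are integrable against `fermiWeight`. -/
theorem integrable_mul_fermiWeight {h : ℝ → ℝ} (hh : Continuous h) {B : ℝ} {k : ℕ}
    (hB : ∀ x, |h x| ≤ B * (1 + |x|) ^ k) : Integrable fun x => h x * fermiWeight x := by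
  refine ((integrable_one_add_abs_pow_mul_exp_neg_abs k).const_mul B).mono'
    (hh.mul continuous_fermiWeight).aestronglyMeasurable (ae_of_all _ fun x => ?_)
  rw [norm_mul, Real.norm_of_nonneg (fermiWeight_nonneg x), Real.norm_eq_abs, ← mul_assoc]
  exact mul_le_mul (hB x) (fermiWeight_le_exp_neg_abs x) (fermiWeight_nonneg x)
    ((abs_nonneg _).trans (hB x))

theorem integrable_fermiWeight : Integrable fermiWeight := by
  simpa using integrable_mul_fermiWeight (h := fun _ => 1) continuous_const (B := 1) (k := 0)
    (by simp)

theorem integral_fermiWeight : ∫ x, fermiWeight x = 1 := by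
  have hbot : Tendsto (fun y : ℝ => -(1 + Real.exp y)⁻¹) atBot (nhds (-1)) := by
    have := ((Real.tendsto_exp_atBot.const_add 1).inv₀ (by norm_num)).neg
    simpa using this
  have htop : Tendsto (fun y : ℝ => -(1 + Real.exp y)⁻¹) atTop (nhds 0) := by
    have := (tendsto_atTop_add_const_left _ 1 Real.tendsto_exp_atTop).inv_tendsto_atTop.neg
    simpa using this
  have := integral_of_hasDerivAt_of_tendsto
    (fun x => by simpa using (hasDerivAt_fermi x).fun_neg) integrable_fermiWeight hbot htop
  simpa using this

theorem integral_id_mul_fermiWeight : ∫ x, x * fermiWeight x = 0 := by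
  have h := integral_neg_eq_self (fun x : ℝ => x * fermiWeight x) volume
  simp only [fermiWeight_neg, neg_mul, integral_neg] at h
  linarith

theorem hasSum_alternating_zeta_two :
    HasSum (fun n : ℕ => (-1 : ℝ) ^ (n + 1) / (n : ℝ) ^ 2) (Real.pi ^ 2 / 12) := by
  have heven : HasSum (fun n : ℕ => if Even n then (1 : ℝ) / (n : ℝ) ^ 2 else 0)
      (1 / 4 * (Real.pi ^ 2 / 6)) := by
    have hinj : Function.Injective fun n : ℕ => 2 * n := fun a b h => by
      simpa using h
    refine (hinj.hasSum_iff ?_).mp ?_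
    · intro n hn
      rw [if_neg]
      rintro ⟨m, rfl⟩
      exact hn ⟨m, by simp; ring⟩
    · convert! hasSum_zeta_two.mul_left (1 / 4) using 1
      ext n
      simp
      ring
  convert! hasSum_zeta_two.sub (heven.mul_left 2) using 1
  · ext n
    rcases Nat.even_or_odd n with h | h
    · simp [h, pow_succ]
      ring
    · simp [h, pow_succ, Nat.not_even_iff_odd.mpr h]
  · ring

theorem hasSum_fermiWeight {x : ℝ} (hx : 0 < x) :
    HasSum (fun n : ℕ => (-1 : ℝ) ^ (n + 1) * (n * Real.exp (-(n * x)))) (fermiWeight x) := by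
  have hr : ‖-Real.exp (-x)‖ < 1 := by
    rw [norm_neg, Real.norm_of_nonneg (Real.exp_pos _).le]
    simpa using hx
  convert! (hasSum_coe_mul_geometric_of_norm_lt_one hr).neg using 1
  · ext n
    rw [neg_pow (Real.exp (-x)), ← Real.exp_nat_mul, pow_succ]
    ring_nf
  · rw [← fermiWeight_neg, fermiWeight]
    ring

theorem integral_Ioi_sq_mul_exp_neg {n : ℕ} (hn : n ≠ 0) :
    ∫ x in Set.Ioi (0 : ℝ), x ^ 2 * Real.exp (-(n * x)) = 2 / (n : ℝ) ^ 3 := by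
  have hn' : (0 : ℝ) < n := by positivity
  have h := Real.integral_rpow_mul_exp_neg_mul_Ioi (a := 3) (r := n) (by norm_num) hn'
  have h3 : Real.Gamma 3 = 2 := by
    have := Real.Gamma_nat_eq_factorial 2
    norm_num [Nat.factorial] at this ⊢
  norm_num [h3] at h
  rw [h]
  ring

theorem integrableOn_Ioi_sq_mul_exp_neg {n : ℕ} (hn : n ≠ 0) :
    IntegrableOn (fun x : ℝ => x ^ 2 * Real.exp (-(n * x))) (Set.Ioi 0) := by
  refine Integrable.of_integral_ne_zero ?_
  rw [integral_Ioi_sq_mul_exp_neg hn]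
  positivity

theorem integral_sq_mul_fermiWeight : ∫ x, x ^ 2 * fermiWeight x = Real.pi ^ 2 / 3 := by
  have hterm : ∀ n : ℕ, ∫ x in Set.Ioi (0 : ℝ), x ^ 2 * (n * Real.exp (-(n * x))) =
      2 * (1 / (n : ℝ) ^ 2) := by
    intro n
    rcases eq_or_ne n 0 with rfl | hn
    · simp
    · simp_rw [mul_left_comm _ (n : ℝ)]
      rw [integral_const_mul, integral_Ioi_sq_mul_exp_neg hn]
      field_simp
  have hhalf : HasSum (fun n : ℕ => 2 * ((-1 : ℝ) ^ (n + 1) / (n : ℝ) ^ 2))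
      (∫ x in Set.Ioi (0 : ℝ), x ^ 2 * fermiWeight x) := by
    have h := hasSum_integral_of_summable_integral_norm (μ := volume.restrict (Set.Ioi (0 : ℝ)))
      (F := fun (n : ℕ) x => (-1 : ℝ) ^ (n + 1) * (x ^ 2 * (n * Real.exp (-(n * x))))) ?_ ?_
    · convert! h using 1
      · ext n
        rw [integral_const_mul, hterm]
        ring
      · refine setIntegral_congr_fun measurableSet_Ioi fun x hx => ?_
        rw [← ((hasSum_fermiWeight hx).mul_left (x ^ 2)).tsum_eq]
        simp_rw [mul_left_comm]
    · intro n
      rcases eq_or_ne n 0 with rfl | hn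
      · simp
      · simp_rw [mul_left_comm _ (n : ℝ)]
        exact ((integrableOn_Ioi_sq_mul_exp_neg hn).const_mul _).const_mul _
    · have hnorm : ∀ (n : ℕ) (x : ℝ), ‖(-1 : ℝ) ^ (n + 1) * (x ^ 2 * (n * Real.exp (-(n * x))))‖ =
          x ^ 2 * (n * Real.exp (-(n * x))) := fun n x => by
        rw [norm_mul, norm_pow, norm_neg, norm_one, one_pow, one_mul,
          Real.norm_of_nonneg (by positivity)]
      simp_rw [hnorm, hterm]
      exact hasSum_zeta_two.summable.mul_left 2
  have habs := integral_comp_abs (f := fun x => x ^ 2 * fermiWeight x)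
  simp only [sq_abs, fermiWeight_abs] at habs
  rw [habs, hhalf.unique (hasSum_alternating_zeta_two.mul_left 2)]
  ring

theorem one_add_abs_affine_pow_le (m T x : ℝ) (k : ℕ) :
    (1 + |m + T * x|) ^ k ≤ (1 + |m| + |T|) ^ k * (1 + |x|) ^ k := by
  rw [← mul_pow]
  gcongr
  have h := abs_add_le m (T * x)
  rw [abs_mul] at h
  nlinarith [mul_nonneg (abs_nonneg m) (abs_nonneg x), abs_nonneg x, abs_nonneg T]

theorem integrable_comp_affine_mul_fermiWeight {h : ℝ → ℝ} (hh : Continuous h) {C : ℝ} {k : ℕ}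
    (hC : 0 ≤ C) (hbd : ∀ E, |h E| ≤ C * (1 + |E|) ^ k) (m T : ℝ) :
    Integrable fun x => h (m + T * x) * fermiWeight x := by
  refine integrable_mul_fermiWeight (hh.comp (by fun_prop))
    (B := C * (1 + |m| + |T|) ^ k) (k := k) fun x => ?_
  rw [mul_assoc]
  exact (hbd _).trans (mul_le_mul_of_nonneg_left (one_add_abs_affine_pow_le m T x k) hC)

/-- A continuous function of polynomial growth that vanishes on the negative half-line is
integrable against the Fermi function. -/
theorem integrable_comp_affine_mul_fermi {h : ℝ → ℝ} (hh : Continuous h) {C : ℝ} {k : ℕ}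
    (hC : 0 ≤ C) (hbd : ∀ E, |h E| ≤ C * (1 + |E|) ^ k) (h0 : ∀ E < 0, h E = 0)
    (m : ℝ) {T : ℝ} (hT : 0 < T) :
    Integrable fun x => h (m + T * x) * (1 + Real.exp x)⁻¹ := by
  refine ((integrable_one_add_abs_pow_mul_exp_neg_abs k).const_mul
    (C * (1 + |m| + |T|) ^ k * Real.exp (2 * |m / T|))).mono'
    (Continuous.aestronglyMeasurable ?_) (ae_of_all _ fun x => ?_)
  · exact (hh.comp (by fun_prop)).mul
      (Continuous.inv₀ (by fun_prop) fun x => by positivity)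
  · rcases lt_or_ge (m + T * x) 0 with hneg | hpos
    · rw [h0 _ hneg, zero_mul, norm_zero]
      positivity
    · have hx : -|m / T| ≤ x := by
        have : -(m / T) ≤ x := by
          rw [← neg_div, div_le_iff₀ hT]
          linarith
        linarith [le_abs_self (m / T)]
      have hf : (1 + Real.exp x)⁻¹ ≤ Real.exp (2 * |m / T|) * Real.exp (-|x|) := by
        calc (1 + Real.exp x)⁻¹ ≤ (Real.exp x)⁻¹ := by
              gcongr
              linarith
          _ = Real.exp (-x) := (Real.exp_neg x).symm
          _ ≤ Real.exp (2 * |m / T| + -|x|) := by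
              gcongr
              rcases abs_cases x with h | h <;> linarith [abs_nonneg (m / T)]
          _ = _ := Real.exp_add _ _
      rw [norm_mul, Real.norm_of_nonneg (by positivity : 0 ≤ (1 + Real.exp x)⁻¹), Real.norm_eq_abs]
      calc |h (m + T * x)| * (1 + Real.exp x)⁻¹
          ≤ (C * ((1 + |m| + |T|) ^ k * (1 + |x|) ^ k)) *
              (Real.exp (2 * |m / T|) * Real.exp (-|x|)) := by
            refine mul_le_mul ((hbd _).trans ?_) hf (by positivity) (by positivity)
            gcongr
            exact one_add_abs_affine_pow_le m T x k
        _ = _ := by ring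

/-- The density of particles as an average of the integrated density of states. -/
theorem integral_deriv_mul_fermi {N : ℝ → ℝ} (hN : ContDiff ℝ 1 N)
    (hN0 : ∀ E ≤ (0 : ℝ), N E = 0) {C : ℝ} {k : ℕ} (hC : 0 ≤ C)
    (hbd : ∀ E, |N E| ≤ C * (1 + |E|) ^ k) (hbd' : ∀ E, |deriv N E| ≤ C * (1 + |E|) ^ k)
    (m : ℝ) {T : ℝ} (hT : 0 < T) :
    ∫ E, deriv N E * (1 + Real.exp ((E - m) / T))⁻¹ = ∫ x, N (m + T * x) * fermiWeight x := by
  have hN0' : ∀ E < (0 : ℝ), deriv N E = 0 := fun E hE => by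
    have : N =ᶠ[nhds E] fun _ => 0 := by
      filter_upwards [Iio_mem_nhds hE] with y hy using hN0 y (le_of_lt hy)
    rw [this.deriv_eq, deriv_const]
  have hsubst : ∫ E, deriv N E * (1 + Real.exp ((E - m) / T))⁻¹ =
      ∫ x, T * deriv N (m + T * x) * (1 + Real.exp x)⁻¹ := by
    have h1 := Measure.integral_comp_mul_left
      (fun y => deriv N (m + y) * (1 + Real.exp (y / T))⁻¹) T
    have h2 := integral_add_left_eq_self (μ := volume)
      (fun E => deriv N E * (1 + Real.exp ((E - m) / T))⁻¹) m
    simp only [add_sub_cancel_left] at h2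
    simp only [mul_div_cancel_left₀ _ hT.ne', abs_of_pos (inv_pos.mpr hT), smul_eq_mul] at h1
    simp_rw [mul_assoc]
    rw [integral_const_mul, h1, h2, mul_inv_cancel_left₀ hT.ne']
  have hderiv : ∀ x, HasDerivAt (fun x => N (m + T * x)) (T * deriv N (m + T * x)) x := fun x => by
    have h1 : HasDerivAt (fun x : ℝ => m + T * x) T x := by
      simpa using ((hasDerivAt_id x).const_mul T).const_add m
    have h2 := (hN.differentiable one_ne_zero (m + T * x)).hasDerivAt.comp x h1
    rwa [mul_comm] at h2
  have hparts := integral_mul_deriv_eq_deriv_mul_of_integrable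
    (u := fun x => N (m + T * x)) (v := fun x => (1 + Real.exp x)⁻¹)
    (fun x _ => hderiv x) (fun x _ => hasDerivAt_fermi x)
    (by simpa [Pi.mul_def] using
      (integrable_comp_affine_mul_fermiWeight hN.continuous hC hbd m T).neg)
    (by
      simpa [Pi.mul_def, mul_assoc] using (integrable_comp_affine_mul_fermi
        (hN.continuous_deriv le_rfl) hC hbd' hN0' m hT).const_mul T)
    (integrable_comp_affine_mul_fermi hN.continuous hC hbd (fun E hE => hN0 E hE.le) m hT)
  simp only [mul_neg, integral_neg, neg_inj] at hparts
  rw [hsubst, hparts]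

/-- Second-order Taylor estimate: if `N″` is within `δ` of `c` between `a` and `b`, then the
first-order Taylor remainder of `N` is within `δ (b - a)²` of `c (b - a)² / 2`. -/
theorem abs_taylor_remainder_sub_le {N : ℝ → ℝ} (hN : ContDiff ℝ 2 N) {a b c δ : ℝ}
    (hδ : ∀ y ∈ Set.uIcc a b, |deriv (deriv N) y - c| ≤ δ) :
    |N b - N a - deriv N a * (b - a) - c * (b - a) ^ 2 / 2| ≤ δ * (b - a) ^ 2 := by
  have hN1 : ContDiff ℝ 1 (deriv N) := (contDiff_succ_iff_deriv.mp
    (show ContDiff ℝ (1 + 1) N by simpa [one_add_one_eq_two] using hN)).2.2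
  have hd : ∀ y, HasDerivAt N (deriv N y) y := fun y =>
    (hN.differentiable two_ne_zero y).hasDerivAt
  have hd' : ∀ y, HasDerivAt (deriv N) (deriv (deriv N) y) y := fun y =>
    (hN1.differentiable one_ne_zero y).hasDerivAt
  have hδ0 : 0 ≤ δ := (abs_nonneg _).trans (hδ a Set.left_mem_uIcc)
  have hconv : Convex ℝ (Set.uIcc a b) := convex_uIcc a b
  have hfirst : ∀ y ∈ Set.uIcc a b, ‖deriv N y - (deriv N a + c * (y - a))‖ ≤ δ * |b - a| := by
    intro y hy
    have h := hconv.norm_image_sub_le_of_norm_hasDerivWithin_le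
      (f := fun y => deriv N y - c * y) (f' := fun y => deriv (deriv N) y - c) (C := δ)
      (fun z _ => ((hd' z).fun_sub (by simpa using (hasDerivAt_id z).const_mul c)).hasDerivWithinAt)
      hδ Set.left_mem_uIcc hy
    have hya : |y - a| ≤ |b - a| := Set.abs_sub_left_of_mem_uIcc hy
    calc ‖deriv N y - (deriv N a + c * (y - a))‖
        = ‖deriv N y - c * y - (deriv N a - c * a)‖ := by congr 1; ring
      _ ≤ δ * ‖y - a‖ := h
      _ ≤ δ * |b - a| := by
        rw [Real.norm_eq_abs]
        gcongr
  have h := hconv.norm_image_sub_le_of_norm_hasDerivWithin_le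
    (f := fun y => N y - (deriv N a * (y - a) + c * (y - a) ^ 2 / 2))
    (f' := fun y => deriv N y - (deriv N a + c * (y - a))) (C := δ * |b - a|)
    (fun z _ => ((hd z).fun_sub (by
      have h1 : HasDerivAt (fun y => y - a) 1 z := (hasDerivAt_id z).sub_const a
      convert! (h1.const_mul (deriv N a)).fun_add (((h1.fun_pow 2).const_mul c).div_const 2) using 1
      norm_num
      ring)).hasDerivWithinAt)
    hfirst Set.left_mem_uIcc Set.right_mem_uIcc
  rw [Real.norm_eq_abs, Real.norm_eq_abs, mul_assoc, ← sq, sq_abs] at h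
  convert! h using 2
  ring

/-- Second-order expansion of averages of `N` against `fermiWeight` at small scale. -/
theorem tendsto_integral_fermiWeight_remainder {N : ℝ → ℝ} (hN : ContDiff ℝ 2 N) {C : ℝ} {k : ℕ}
    (hC : 0 ≤ C) (hbd : ∀ E, |N E| ≤ C * (1 + |E|) ^ k)
    (hbd'' : ∀ E, |deriv (deriv N) E| ≤ C * (1 + |E|) ^ k) {ε : ℝ} {μ : ℝ → ℝ}
    (hμ : Tendsto μ (nhdsWithin 0 (Set.Ioi 0)) (nhds ε)) :
    Tendsto (fun T : ℝ => ((∫ x, N (μ T + T * x) * fermiWeight x) - N (μ T)) / T ^ 2)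
      (nhdsWithin 0 (Set.Ioi 0)) (nhds (Real.pi ^ 2 / 6 * deriv (deriv N) ε)) := by
  have hN2 : Continuous (deriv (deriv N)) := ((contDiff_succ_iff_deriv.mp
    (show ContDiff ℝ (1 + 1) N by simpa [one_add_one_eq_two] using hN)).2.2).continuous_deriv le_rfl
  have hT0 : ∀ᶠ T : ℝ in nhdsWithin 0 (Set.Ioi 0), 0 < T := self_mem_nhdsWithin
  have hid : Tendsto (fun T : ℝ => T) (nhdsWithin 0 (Set.Ioi 0)) (nhds 0) :=
    tendsto_nhdsWithin_of_tendsto_nhds tendsto_id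
  set R : ℝ → ℝ → ℝ := fun T x => (N (μ T + T * x) - N (μ T) - deriv N (μ T) * (T * x)) / T ^ 2
    with hR
  have hlim : Tendsto (fun T => ∫ x, R T x * fermiWeight x) (nhdsWithin 0 (Set.Ioi 0))
      (nhds (∫ x, (deriv (deriv N) ε / 2 * x ^ 2) * fermiWeight x)) := by
    refine tendsto_integral_filter_of_dominated_convergence
      (fun x => (C * (2 + |ε|) ^ k * (1 + |x|) ^ (k + 2)) * fermiWeight x) ?_ ?_ ?_ ?_
    · refine Eventually.of_forall fun T => Continuous.aestronglyMeasurable ?_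
      have := hN.continuous
      have := continuous_fermiWeight
      fun_prop
    · filter_upwards [hT0, hid.eventually_le_const zero_lt_one,
        hμ.abs.eventually_le_const (lt_add_one |ε|)] with T hT hT1 hμT
      refine ae_of_all _ fun x => ?_
      rw [norm_mul, Real.norm_of_nonneg (fermiWeight_nonneg x), Real.norm_eq_abs]
      refine mul_le_mul_of_nonneg_right ?_ (fermiWeight_nonneg x)
      have hb := abs_taylor_remainder_sub_le hN (a := μ T) (b := μ T + T * x) (c := 0)
        (δ := C * ((2 + |ε|) ^ k * (1 + |x|) ^ k)) fun y hy => by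
          rw [sub_zero]
          refine (hbd'' y).trans ?_
          rw [← mul_pow]
          gcongr
          have hy' : |y - μ T| ≤ T * |x| := by
            simpa [abs_mul, abs_of_pos hT] using Set.abs_sub_left_of_mem_uIcc hy
          have := abs_sub_abs_le_abs_sub y (μ T)
          nlinarith [abs_nonneg x, abs_nonneg ε, mul_nonneg (abs_nonneg x) (abs_nonneg ε)]
      simp only [add_sub_cancel_left, zero_mul, zero_div, sub_zero] at hb
      rw [hR, abs_div, abs_of_pos (pow_pos hT 2), div_le_iff₀ (pow_pos hT 2)]
      refine hb.trans ?_
      calc C * ((2 + |ε|) ^ k * (1 + |x|) ^ k) * (T * x) ^ 2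
          = C * (2 + |ε|) ^ k * ((1 + |x|) ^ k * |x| ^ 2) * T ^ 2 := by rw [sq_abs]; ring
        _ ≤ C * (2 + |ε|) ^ k * ((1 + |x|) ^ k * (1 + |x|) ^ 2) * T ^ 2 := by
          gcongr
          linarith
        _ = _ := by ring
    · refine integrable_mul_fermiWeight (by fun_prop) (B := C * (2 + |ε|) ^ k) (k := k + 2)
        fun x => ?_
      rw [abs_of_nonneg (by positivity)]
    · refine ae_of_all _ fun x => Tendsto.mul_const _ ?_
      rw [Metric.tendsto_nhds]
      intro η hη
      set δ := η / (x ^ 2 + 1) with hδ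
      have hδ0 : 0 < δ := by positivity
      obtain ⟨ρ, hρ, hball⟩ := Metric.continuousAt_iff.mp (hN2.continuousAt (x := ε)) δ hδ0
      have hμx : Tendsto (fun T => μ T + T * x) (nhdsWithin 0 (Set.Ioi 0)) (nhds ε) := by
        simpa using hμ.add (hid.mul_const x)
      filter_upwards [hT0, hμ.eventually (Metric.ball_mem_nhds ε hρ),
        hμx.eventually (Metric.ball_mem_nhds ε hρ)] with T hT h1 h2
      have hb := abs_taylor_remainder_sub_le hN (a := μ T) (b := μ T + T * x)
        (c := deriv (deriv N) ε) (δ := δ) fun y hy =>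
          (hball ((convex_ball ε ρ).ordConnected.uIcc_subset h1 h2 hy)).le
      simp only [add_sub_cancel_left] at hb
      have hT2 : 0 < T ^ 2 := pow_pos hT 2
      have heq : R T x - deriv (deriv N) ε / 2 * x ^ 2 =
          (N (μ T + T * x) - N (μ T) - deriv N (μ T) * (T * x) -
            deriv (deriv N) ε * (T * x) ^ 2 / 2) / T ^ 2 := by
        rw [hR]
        field_simp
      rw [Real.dist_eq, heq, abs_div, abs_of_pos hT2, div_lt_iff₀ hT2]
      refine hb.trans_lt ?_
      have : δ * x ^ 2 < η := by
        rw [hδ, div_mul_eq_mul_div, div_lt_iff₀ (by positivity)]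
        nlinarith
      nlinarith
  have hval : ∫ x, (deriv (deriv N) ε / 2 * x ^ 2) * fermiWeight x =
      Real.pi ^ 2 / 6 * deriv (deriv N) ε := by
    simp_rw [mul_assoc]
    rw [integral_const_mul, integral_sq_mul_fermiWeight]
    ring
  rw [hval] at hlim
  refine hlim.congr' ?_
  filter_upwards [hT0] with T hT
  have hint := integrable_comp_affine_mul_fermiWeight hN.continuous hC hbd (μ T) T
  have hint1 : Integrable fun x => x * fermiWeight x :=
    integrable_mul_fermiWeight continuous_id (B := 1) (k := 1) fun x => by simp
  have hexpand : ∀ x, R T x * fermiWeight x = (N (μ T + T * x) * fermiWeight x -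
      N (μ T) * fermiWeight x - deriv N (μ T) * T * (x * fermiWeight x)) / T ^ 2 := fun x => by
    rw [hR]
    ring
  simp_rw [hexpand]
  have hdiff : Integrable fun x => N (μ T + T * x) * fermiWeight x - N (μ T) * fermiWeight x :=
    hint.sub (integrable_fermiWeight.const_mul _)
  rw [integral_div, integral_sub hdiff (hint1.const_mul _),
    integral_sub hint (integrable_fermiWeight.const_mul _), integral_const_mul, integral_const_mul,
    integral_fermiWeight, integral_id_mul_fermiWeight]
  simp

/-- Low-temperature expansion of the chemical potential at fixed particle density:
let `N` be a `C²` integrated density of states vanishing on `(-∞,0]` and of polynomial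
growth up to second derivatives, let `ε_F > 0` with `N′(ε_F) > 0`, and suppose
`μ : (0,T₁) → ℝ` satisfies `∫ N′(E) f_T(E-μ(T)) dE = N(ε_F)` for `T ∈ (0,T₁)` and
`μ(T) → ε_F` as `T → 0⁺`, where `f_T(E) = (1+exp(E/T))⁻¹`. Then
`(μ(T) − ε_F)/T² → −(π²/6)·N″(ε_F)/N′(ε_F)` as `T → 0⁺`. -/
theorem chemical_potential_low_temperature (N : ℝ → ℝ) (hN : ContDiff ℝ 2 N)
    (hN0 : ∀ E ≤ (0 : ℝ), N E = 0) (C : ℝ) (k : ℕ) (hC : 0 < C)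
    (hbd : ∀ E : ℝ, |N E| + |deriv N E| + |deriv (deriv N) E| ≤ C * (1 + |E|) ^ k)
    (εF : ℝ) (hεF : 0 < εF) (hN' : 0 < deriv N εF)
    (T₁ : ℝ) (hT₁ : 0 < T₁) (μ : ℝ → ℝ)
    (hdens : ∀ T ∈ Set.Ioo (0 : ℝ) T₁,
        ∫ E : ℝ, deriv N E * (1 + Real.exp ((E - μ T) / T))⁻¹ = N εF)
    (hμ : Tendsto μ (nhdsWithin 0 (Set.Ioi 0)) (nhds εF)) :
    Tendsto (fun T : ℝ => (μ T - εF) / T ^ 2) (nhdsWithin 0 (Set.Ioi 0))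
      (nhds (-(Real.pi ^ 2 / 6) * (deriv (deriv N) εF / deriv N εF))) := by
  have hbound : ∀ E, |N E| ≤ C * (1 + |E|) ^ k ∧ |deriv N E| ≤ C * (1 + |E|) ^ k ∧
      |deriv (deriv N) E| ≤ C * (1 + |E|) ^ k := fun E => by
    have := hbd E
    have := abs_nonneg (N E)
    have := abs_nonneg (deriv N E)
    have := abs_nonneg (deriv (deriv N) E)
    refine ⟨?_, ?_, ?_⟩ <;> linarith
  have hexp := tendsto_integral_fermiWeight_remainder hN hC.le (fun E => (hbound E).1)
    (fun E => (hbound E).2.2) hμ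
  have hslope : Tendsto (fun T => dslope N εF (μ T)) (nhdsWithin 0 (Set.Ioi 0))
      (nhds (deriv N εF)) := by
    have h := continuousAt_dslope_same.mpr (hN.differentiable two_ne_zero εF)
    rw [ContinuousAt, dslope_same] at h
    exact h.comp hμ
  have hquot := (hexp.div hslope hN'.ne').neg
  rw [show -(Real.pi ^ 2 / 6) * (deriv (deriv N) εF / deriv N εF) =
    -(Real.pi ^ 2 / 6 * deriv (deriv N) εF / deriv N εF) by ring]
  refine hquot.congr' ?_
  filter_upwards [Ioo_mem_nhdsGT hT₁, hslope.eventually_ne hN'.ne'] with T hT hne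
  have hfactor := sub_smul_dslope N εF (μ T)
  rw [smul_eq_mul] at hfactor
  have hdensity := hdens T hT
  rw [integral_deriv_mul_fermi (hN.of_le one_le_two) hN0 hC.le (fun E => (hbound E).1)
    (fun E => (hbound E).2.1) (μ T) hT.1] at hdensity
  have hT0 : T ≠ 0 := hT.1.ne'
  rw [Pi.div_apply, hdensity, ← neg_sub (N (μ T)), ← hfactor]
  field_simp
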